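/- Let n ≥ 2 be an integer and s > n/2 a real number with 2s ∈ ℤ, and work on (0, π/2]. Let q ≥ 1 be an odd integer, set ν = s + q and m = (q + 1)/2, and define the linear map J sending a tuple (b₀, …, b_m) of functions in A⁰ to the tuple (c₀, …, c_m) given by c_i(θ) = (I_{s,ν} b_i)(θ) + (i + 1)(ν − i)·sin²(θ)·b_{i+1}(θ) + (i + 2)(i + 1)·sin²(θ)·b_{i+2}(θ), where b_j := 0 for j > m. Then J is well defined (each c_i lies in B) and is a bijection from (A⁰)^{m+1} onto B^{m+1}. -/

import Mathlib

open Real Set Filter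

/-- One-sided derivative on `(0, π/2]`. -/
noncomputable def dW (u : ℝ → ℝ) : ℝ → ℝ := derivWithin u (Set.Ioc 0 (Real.pi / 2))

/-- The indicial operator `I_{s,ν}` on `(0, π/2]`, with derivatives taken within
`(0, π/2]`. -/
noncomputable def IopW (n : ℕ) (s ν : ℝ) (u : ℝ → ℝ) (θ : ℝ) : ℝ :=
  Real.sin θ ^ 2 * dW (dW u) θ
    + (1 - (n : ℝ)) * Real.sin θ * Real.cos θ * dW u θ
    + ν * (ν + 1 - (n : ℝ)) * Real.sin θ ^ 2 * u θ + s * ((n : ℝ) - s) * u θ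

/-- Membership in `A⁰`: `u(θ) = θ^{n-s} g₀(θ) + θ^s log(θ) g₁(θ)` with `g₀, g₁`
smooth up to the boundary, `θ^{s-n} u(θ) → 0` as `θ → 0⁺`, and `u'(π/2) = 0`. -/
def memA0 (n : ℕ) (s : ℝ) (u : ℝ → ℝ) : Prop :=
  (∃ g₀ g₁ : ℝ → ℝ, ContDiff ℝ (⊤ : ℕ∞) g₀ ∧ ContDiff ℝ (⊤ : ℕ∞) g₁ ∧
    ∀ θ ∈ Set.Ioc 0 (Real.pi / 2),
      u θ = θ ^ ((n : ℝ) - s) * g₀ θ + θ ^ s * Real.log θ * g₁ θ) ∧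
  Filter.Tendsto (fun θ => θ ^ (s - (n : ℝ)) * u θ)
    (nhdsWithin 0 (Set.Ioi 0)) (nhds 0) ∧
  dW u (Real.pi / 2) = 0

/-- Membership in `B`: `f(θ) = θ^{n-s+1} g₀(θ) + θ^{s+1} log(θ) g₁(θ)` with
`g₀, g₁` smooth up to the boundary. -/
def memB (n : ℕ) (s : ℝ) (f : ℝ → ℝ) : Prop :=
  ∃ g₀ g₁ : ℝ → ℝ, ContDiff ℝ (⊤ : ℕ∞) g₀ ∧ ContDiff ℝ (⊤ : ℕ∞) g₁ ∧
    ∀ θ ∈ Set.Ioc 0 (Real.pi / 2),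
      f θ = θ ^ ((n : ℝ) - s + 1) * g₀ θ + θ ^ (s + 1) * Real.log θ * g₁ θ

/-- The map `J` on tuples of coefficient functions:
`(J b)_i = I_{s,ν} b_i + (i+1)(ν-i) sin²θ · b_{i+1} + (i+2)(i+1) sin²θ · b_{i+2}`. -/
noncomputable def Jmap (n : ℕ) (s ν : ℝ) (b : ℕ → ℝ → ℝ) (i : ℕ) (θ : ℝ) : ℝ :=
  IopW n s ν (b i) θ
    + ((i : ℝ) + 1) * (ν - (i : ℝ)) * Real.sin θ ^ 2 * b (i + 1) θ
    + ((i : ℝ) + 2) * ((i : ℝ) + 1) * Real.sin θ ^ 2 * b (i + 2) θ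

open scoped ContDiff Topology

/-- The operator `g ↦ (x ↦ ∫₀¹ tʲ g(t x) dt)`, a right inverse of `(j + 1) + x d/dx`. -/
noncomputable def eulerInv (j : ℕ) (g : ℝ → ℝ) (x : ℝ) : ℝ :=
  ∫ t in (0 : ℝ)..1, t ^ j * g (t * x)

lemma hasDerivAt_eulerInv (j : ℕ) {g : ℝ → ℝ} (hg : ContDiff ℝ 1 g) (x : ℝ) :
    HasDerivAt (eulerInv j g) (eulerInv (j + 1) (deriv g) x) x := by
  have hg' : Continuous (deriv g) := hg.continuous_deriv le_rfl
  have hgc : Continuous g := hg.continuous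
  obtain ⟨C, hC⟩ := (isCompact_Icc (a := -(|x| + 1)) (b := |x| + 1)).exists_bound_of_continuousOn
    hg'.continuousOn
  refine (intervalIntegral.hasDerivAt_integral_of_dominated_loc_of_deriv_le
    (F := fun x t => t ^ j * g (t * x)) (F' := fun x t => t ^ (j + 1) * deriv g (t * x))
    (bound := fun _ => C) (Metric.ball_mem_nhds x one_pos) ?_ ?_ ?_ ?_ ?_ ?_).2
  · exact Eventually.of_forall fun y => (by fun_prop : Continuous _).aestronglyMeasurable
  · exact (by fun_prop : Continuous _).intervalIntegrable _ _
  · exact (by fun_prop : Continuous _).aestronglyMeasurable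
  · refine Eventually.of_forall fun t ht y hy => ?_
    rw [uIoc_of_le zero_le_one] at ht
    have hy' : |y| ≤ |x| + 1 := by
      have h1 : |y - x| < 1 := by simpa [Real.dist_eq] using hy
      have h2 := abs_sub_abs_le_abs_sub y x
      linarith
    have hty : |t * y| ≤ |x| + 1 := by
      rw [abs_mul, abs_of_pos ht.1]
      nlinarith [abs_nonneg y, ht.2, ht.1]
    have hb := hC (t * y) (abs_le.1 hty)
    rw [norm_mul, norm_pow, Real.norm_eq_abs, abs_of_pos ht.1]
    have : t ^ (j + 1) ≤ 1 := pow_le_one₀ ht.1.le ht.2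
    nlinarith [norm_nonneg (deriv g (t * y)), pow_pos ht.1 (j + 1)]
  · simp
  · refine Eventually.of_forall fun t _ y _ => ?_
    have h1 : HasDerivAt g (deriv g (t * y)) (t * y) :=
      (hg.differentiable one_ne_zero _).hasDerivAt
    have h2 : HasDerivAt (fun y => g (t * y)) (deriv g (t * y) * (t * 1)) y :=
      h1.comp y ((hasDerivAt_id y).const_mul t)
    exact (h2.const_mul (t ^ j)).congr_deriv (by ring)

lemma contDiff_deriv_of_smooth {g : ℝ → ℝ} (hg : ContDiff ℝ ∞ g) : ContDiff ℝ ∞ (deriv g) :=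
  (contDiff_infty_iff_deriv.1 hg).2

lemma contDiff_eulerInv (j : ℕ) {g : ℝ → ℝ} (hg : ContDiff ℝ ∞ g) :
    ContDiff ℝ ∞ (eulerInv j g) := by
  refine contDiff_infty.2 fun N => ?_
  induction N generalizing j g with
  | zero =>
    exact contDiff_zero.2 <| continuous_iff_continuousAt.2 fun x =>
      (hasDerivAt_eulerInv j (hg.of_le (by exact_mod_cast le_top)) x).continuousAt
  | succ N ih =>
    have hd := fun x => hasDerivAt_eulerInv j (hg.of_le (by exact_mod_cast le_top)) x
    have : deriv (eulerInv j g) = eulerInv (j + 1) (deriv g) := funext fun x => (hd x).deriv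
    push_cast
    refine contDiff_succ_iff_deriv.2 ⟨fun x => (hd x).differentiableAt, by simp, ?_⟩
    rw [this]
    exact ih (j + 1) (contDiff_deriv_of_smooth hg)

/-- The first-order Euler equation `(j + 1) h + x h' = g` has a smooth solution. -/
lemma exists_smooth_euler (j : ℕ) {g : ℝ → ℝ} (hg : ContDiff ℝ ∞ g) :
    ∃ h : ℝ → ℝ, ContDiff ℝ ∞ h ∧ ∀ x, ((j : ℝ) + 1) * h x + x * deriv h x = g x := by
  refine ⟨eulerInv j g, contDiff_eulerInv j hg, fun x => ?_⟩
  have hg1 : ContDiff ℝ 1 g := hg.of_le (by exact_mod_cast le_top)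
  have hg' : Continuous (deriv g) := hg1.continuous_deriv le_rfl
  have hgc : Continuous g := hg1.continuous
  rw [(hasDerivAt_eulerInv j hg1 x).deriv]
  unfold eulerInv
  rw [← intervalIntegral.integral_const_mul, ← intervalIntegral.integral_const_mul,
    ← intervalIntegral.integral_add ((by fun_prop : Continuous _).intervalIntegrable _ _)
      ((by fun_prop : Continuous _).intervalIntegrable _ _)]
  have := intervalIntegral.integral_eq_sub_of_hasDerivAt (a := 0) (b := 1)
    (f := fun t => t ^ (j + 1) * g (t * x))
    (f' := fun t => ((j : ℝ) + 1) * (t ^ j * g (t * x)) + x * (t ^ (j + 1) * deriv g (t * x)))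
    (fun t _ => ?_) ((by fun_prop : Continuous _).intervalIntegrable _ _)
  · rw [this]; simp
  · have h1 : HasDerivAt g (deriv g (t * x)) (t * x) :=
      (hg1.differentiable one_ne_zero _).hasDerivAt
    have h2 : HasDerivAt (fun t => g (t * x)) (deriv g (t * x) * (1 * x)) t :=
      h1.comp t ((hasDerivAt_id t).mul_const x)
    refine ((hasDerivAt_pow (j + 1) t).mul h2).congr_deriv ?_
    push_cast
    ring

/-- Hadamard's lemma: a smooth function vanishing at `0` is `x` times a smooth function. -/
lemma exists_smooth_eq_add_mul {g : ℝ → ℝ} (hg : ContDiff ℝ ∞ g) :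
    ∃ h : ℝ → ℝ, ContDiff ℝ ∞ h ∧ ∀ x, g x = g 0 + x * h x := by
  obtain ⟨h, hh, he⟩ := exists_smooth_euler 0 (contDiff_deriv_of_smooth hg)
  refine ⟨h, hh, fun x => ?_⟩
  have hd : ∀ y, HasDerivAt (fun y => g y - y * h y) 0 y := fun y => by
    have h1 := (hg.differentiable (by simp) y).hasDerivAt
    have h2 := (hh.differentiable (by simp) y).hasDerivAt
    refine (h1.sub ((hasDerivAt_id y).mul h2)).congr_deriv ?_
    have := he y
    rw [Nat.cast_zero] at this
    simp only [id]
    linarith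
  have := is_const_of_deriv_eq_zero (fun y => (hd y).differentiableAt) (fun y => (hd y).deriv) x 0
  simp only [zero_mul, sub_zero] at this
  linarith

lemma exists_smooth_sin_eq_mul :
    ∃ σ : ℝ → ℝ, ContDiff ℝ ∞ σ ∧ σ 0 = 1 ∧ ∀ x, Real.sin x = x * σ x := by
  obtain ⟨σ, hσ, h⟩ := exists_smooth_eq_add_mul Real.contDiff_sin
  simp only [Real.sin_zero, zero_add] at h
  refine ⟨σ, hσ, ?_, h⟩
  have h2 := (hσ.differentiable (by simp) 0).hasDerivAt
  have h1 : HasDerivAt Real.sin (1 * σ 0 + 0 * deriv σ 0) 0 := by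
    have : Real.sin = fun x => x * σ x := funext h
    rw [this]
    exact (hasDerivAt_id (0 : ℝ)).mul h2
  have := h1.unique (Real.hasDerivAt_sin 0)
  simpa using this

lemma exists_smooth_sin_rpow (a : ℝ) :
    ∃ τ : ℝ → ℝ, ContDiff ℝ ∞ τ ∧
      ∀ θ ∈ Set.Ioc 0 (Real.pi / 2), Real.sin θ ^ a = θ ^ a * τ θ := by
  obtain ⟨σ, hσ, hσ0, h⟩ := exists_smooth_sin_eq_mul
  let χ : ContDiffBump (0 : ℝ) := ⟨2, 3, by norm_num, by norm_num⟩
  have hpos : ∀ x, 0 < σ x * χ x + (1 - χ x) := by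
    intro x
    have h0 : 0 ≤ χ x := χ.nonneg
    have h1 : χ x ≤ 1 := χ.le_one
    by_cases hx : |x| < 3
    · have hs : 0 < σ x := by
        rcases lt_trichotomy x 0 with hx0 | hx0 | hx0
        · have := Real.sin_neg_of_neg_of_neg_pi_lt hx0
            (by linarith [Real.pi_gt_three, (abs_lt.1 hx).1])
          rw [h x] at this
          nlinarith
        · rw [hx0, hσ0]; exact one_pos
        · have := Real.sin_pos_of_pos_of_lt_pi hx0
            (by linarith [Real.pi_gt_three, (abs_lt.1 hx).2])
          rw [h x] at this
          exact pos_of_mul_pos_right this hx0.le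
      rcases h0.eq_or_lt with h0 | h0
      · rw [← h0]; norm_num
      · have := mul_pos hs h0
        linarith
    · have : χ x = 0 := χ.zero_of_le_dist (by simpa [Real.dist_eq] using hx)
      rw [this]; norm_num
  refine ⟨fun x => (σ x * χ x + (1 - χ x)) ^ a, ?_, fun θ hθ => ?_⟩
  · have hχ : ContDiff ℝ ∞ χ := χ.contDiff
    exact ((hσ.mul hχ).add (contDiff_const.sub hχ)).rpow_const_of_ne fun x => (hpos x).ne'
  · have h1 : χ θ = 1 := χ.one_of_mem_closedBall (by
      have : |θ| ≤ 2 := by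
        rw [abs_of_pos hθ.1]
        linarith [Real.pi_le_four, hθ.2]
      simpa [Real.dist_eq] using this)
    have h2 := hpos θ
    simp only [h1] at h2 ⊢
    rw [mul_one, sub_self, add_zero] at h2 ⊢
    rw [h θ, Real.mul_rpow hθ.1.le h2.le]

/-- Functions `θᵖ (g₀ + θʲ log θ g₁)` on `(0, π/2]` with `g₀`, `g₁` smooth up to the boundary. -/
def IsLogSmooth (p : ℝ) (j : ℕ) (u : ℝ → ℝ) : Prop :=
  ∃ g₀ g₁ : ℝ → ℝ, ContDiff ℝ ∞ g₀ ∧ ContDiff ℝ ∞ g₁ ∧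
    ∀ θ ∈ Set.Ioc 0 (Real.pi / 2), u θ = θ ^ p * (g₀ θ + θ ^ j * Real.log θ * g₁ θ)

lemma dW_eq_of_hasDerivWithinAt {u : ℝ → ℝ} {d θ : ℝ} (hθ : θ ∈ Set.Ioc 0 (Real.pi / 2))
    (h : HasDerivWithinAt u d (Set.Ioc 0 (Real.pi / 2)) θ) : dW u θ = d :=
  h.derivWithin (uniqueDiffOn_Ioc _ _ θ hθ)

lemma dW_congr {u v : ℝ → ℝ} (h : Set.EqOn u v (Set.Ioc 0 (Real.pi / 2))) :
    Set.EqOn (dW u) (dW v) (Set.Ioc 0 (Real.pi / 2)) :=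
  fun _ hθ => derivWithin_congr h (h hθ)

namespace IsLogSmooth

variable {p : ℝ} {j : ℕ} {u v : ℝ → ℝ}

lemma congr (hu : IsLogSmooth p j u) (h : Set.EqOn v u (Set.Ioc 0 (Real.pi / 2))) :
    IsLogSmooth p j v := by
  obtain ⟨g₀, g₁, h₀, h₁, he⟩ := hu
  exact ⟨g₀, g₁, h₀, h₁, fun θ hθ => (h hθ).trans (he θ hθ)⟩

lemma zero : IsLogSmooth p j fun _ => 0 :=
  ⟨fun _ => 0, fun _ => 0, contDiff_const, contDiff_const, by simp⟩

lemma add (hu : IsLogSmooth p j u) (hv : IsLogSmooth p j v) :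
    IsLogSmooth p j fun θ => u θ + v θ := by
  obtain ⟨g₀, g₁, h₀, h₁, he⟩ := hu
  obtain ⟨k₀, k₁, l₀, l₁, ke⟩ := hv
  refine ⟨fun θ => g₀ θ + k₀ θ, fun θ => g₁ θ + k₁ θ, h₀.add l₀, h₁.add l₁, fun θ hθ => ?_⟩
  simp only [he θ hθ, ke θ hθ]
  ring

lemma smooth_mul (hu : IsLogSmooth p j u) {a : ℝ → ℝ} (ha : ContDiff ℝ ∞ a) :
    IsLogSmooth p j fun θ => a θ * u θ := by
  obtain ⟨g₀, g₁, h₀, h₁, he⟩ := hu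
  refine ⟨fun θ => a θ * g₀ θ, fun θ => a θ * g₁ θ, ha.mul h₀, ha.mul h₁, fun θ hθ => ?_⟩
  simp only [he θ hθ]
  ring

lemma const_mul (hu : IsLogSmooth p j u) (c : ℝ) : IsLogSmooth p j fun θ => c * u θ :=
  hu.smooth_mul contDiff_const

lemma sub (hu : IsLogSmooth p j u) (hv : IsLogSmooth p j v) :
    IsLogSmooth p j fun θ => u θ - v θ :=
  (hu.add (hv.const_mul (-1))).congr fun θ _ => by ring

lemma of_succ (hu : IsLogSmooth p (j + 1) u) : IsLogSmooth p j u := by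
  obtain ⟨g₀, g₁, h₀, h₁, he⟩ := hu
  refine ⟨g₀, fun θ => θ * g₁ θ, h₀, contDiff_id.mul h₁, fun θ hθ => ?_⟩
  rw [he θ hθ]
  ring

lemma sin_mul (hu : IsLogSmooth p j u) : IsLogSmooth (p + 1) j fun θ => Real.sin θ * u θ := by
  obtain ⟨g₀, g₁, h₀, h₁, he⟩ := hu
  obtain ⟨σ, hσ, -, hs⟩ := exists_smooth_sin_eq_mul
  refine ⟨fun θ => σ θ * g₀ θ, fun θ => σ θ * g₁ θ, hσ.mul h₀, hσ.mul h₁, fun θ hθ => ?_⟩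
  simp only [he θ hθ, hs θ, Real.rpow_add_one hθ.1.ne']
  ring

lemma of_add_one (hu : IsLogSmooth (p + 1) j u) : IsLogSmooth p (j + 1) u := by
  obtain ⟨g₀, g₁, h₀, h₁, he⟩ := hu
  refine ⟨fun θ => θ * g₀ θ, g₁, contDiff_id.mul h₀, h₁, fun θ hθ => ?_⟩
  rw [he θ hθ, Real.rpow_add_one hθ.1.ne']
  ring

lemma sin_rpow_mul (hu : IsLogSmooth p j u) (a : ℝ) :
    IsLogSmooth (p + a) j fun θ => Real.sin θ ^ a * u θ := by
  obtain ⟨g₀, g₁, h₀, h₁, he⟩ := hu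
  obtain ⟨τ, hτ, hs⟩ := exists_smooth_sin_rpow a
  refine ⟨fun θ => τ θ * g₀ θ, fun θ => τ θ * g₁ θ, hτ.mul h₀, hτ.mul h₁, fun θ hθ => ?_⟩
  simp only [he θ hθ, hs θ hθ, Real.rpow_add hθ.1]
  ring

end IsLogSmooth

lemma hasDerivAt_rpow_mul_add_log {g₀ g₁ : ℝ → ℝ} (h₀ : ContDiff ℝ ∞ g₀) (h₁ : ContDiff ℝ ∞ g₁)
    (p : ℝ) (j : ℕ) {θ : ℝ} (hθ : 0 < θ) :
    HasDerivAt (fun θ => θ ^ p * (g₀ θ + θ ^ j * Real.log θ * g₁ θ))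
      (θ ^ (p - 1) * ((p * g₀ θ + θ * deriv g₀ θ + θ ^ j * g₁ θ)
        + θ ^ j * Real.log θ * ((p + j) * g₁ θ + θ * deriv g₁ θ))) θ := by
  have d₀ := (h₀.differentiable (by simp) θ).hasDerivAt
  have d₁ := (h₁.differentiable (by simp) θ).hasDerivAt
  have dp := Real.hasDerivAt_rpow_const (p := p) (Or.inl hθ.ne')
  have dl := Real.hasDerivAt_log hθ.ne'
  have dj := hasDerivAt_pow j θ
  refine (dp.mul (d₀.add ((dj.mul dl).mul d₁))).congr_deriv ?_
  have hp : θ ^ p = θ ^ (p - 1) * θ := by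
    rw [← Real.rpow_add_one hθ.ne', sub_add_cancel]
  simp only [Pi.mul_apply, Pi.add_apply]
  rw [hp]
  rcases j with _ | j
  · simp
    field_simp
    ring
  · simp only [Nat.add_sub_cancel]
    push_cast
    field_simp
    ring

namespace IsLogSmooth

variable {p : ℝ} {j : ℕ} {u : ℝ → ℝ}

lemma exists_deriv (hu : IsLogSmooth p j u) :
    ∃ u', IsLogSmooth (p - 1) j u' ∧ ∀ θ ∈ Set.Ioc 0 (Real.pi / 2),
      HasDerivWithinAt u (u' θ) (Set.Ioc 0 (Real.pi / 2)) θ := by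
  obtain ⟨g₀, g₁, h₀, h₁, he⟩ := hu
  have h₀' := contDiff_deriv_of_smooth h₀
  have h₁' := contDiff_deriv_of_smooth h₁
  refine ⟨_, ⟨fun θ => p * g₀ θ + θ * deriv g₀ θ + θ ^ j * g₁ θ,
    fun θ => (p + j) * g₁ θ + θ * deriv g₁ θ, by fun_prop, by fun_prop, fun θ _ => rfl⟩,
    fun θ hθ => ?_⟩
  exact (hasDerivAt_rpow_mul_add_log h₀ h₁ p j hθ.1).hasDerivWithinAt.congr he (he θ hθ)

lemma hasDerivWithinAt (hu : IsLogSmooth p j u) {θ : ℝ} (hθ : θ ∈ Set.Ioc 0 (Real.pi / 2)) :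
    HasDerivWithinAt u (dW u θ) (Set.Ioc 0 (Real.pi / 2)) θ := by
  obtain ⟨u', -, hd⟩ := hu.exists_deriv
  rw [dW_eq_of_hasDerivWithinAt hθ (hd θ hθ)]
  exact hd θ hθ

lemma dW (hu : IsLogSmooth p j u) : IsLogSmooth (p - 1) j (dW u) := by
  obtain ⟨u', hu', hd⟩ := hu.exists_deriv
  exact hu'.congr fun θ hθ => dW_eq_of_hasDerivWithinAt hθ (hd θ hθ)

end IsLogSmooth

/-- The first-order operator `sin θ d/dθ + a cos θ` on `(0, π/2]`. -/
noncomputable def ladder (a : ℝ) (u : ℝ → ℝ) (θ : ℝ) : ℝ :=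
  Real.sin θ * dW u θ + a * Real.cos θ * u θ

lemma ladder_congr (a : ℝ) {u v : ℝ → ℝ} (h : Set.EqOn u v (Set.Ioc 0 (Real.pi / 2))) :
    Set.EqOn (ladder a u) (ladder a v) (Set.Ioc 0 (Real.pi / 2)) := fun θ hθ => by
  simp only [ladder, dW_congr h hθ, h hθ]

lemma IopW_congr (n : ℕ) (s ν : ℝ) {u v : ℝ → ℝ} (h : Set.EqOn u v (Set.Ioc 0 (Real.pi / 2))) :
    Set.EqOn (IopW n s ν u) (IopW n s ν v) (Set.Ioc 0 (Real.pi / 2)) := fun θ hθ => by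
  simp only [IopW, dW_congr (dW_congr h) hθ, dW_congr h hθ, h hθ]

namespace IsLogSmooth

variable {p p' : ℝ} {j j' : ℕ} {u v : ℝ → ℝ}

lemma dW_sub (hu : IsLogSmooth p j u) (hv : IsLogSmooth p' j' v) :
    Set.EqOn (_root_.dW fun θ => u θ - v θ) (fun θ => _root_.dW u θ - _root_.dW v θ)
      (Set.Ioc 0 (Real.pi / 2)) := fun _ hθ =>
  dW_eq_of_hasDerivWithinAt hθ ((hu.hasDerivWithinAt hθ).sub (hv.hasDerivWithinAt hθ))

lemma dW_const_mul (hu : IsLogSmooth p j u) (c : ℝ) :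
    Set.EqOn (_root_.dW fun θ => c * u θ) (fun θ => c * _root_.dW u θ)
      (Set.Ioc 0 (Real.pi / 2)) := fun _ hθ =>
  dW_eq_of_hasDerivWithinAt hθ ((hu.hasDerivWithinAt hθ).const_mul c)

lemma IopW_sub (hu : IsLogSmooth p j u) (hv : IsLogSmooth p' j' v) (n : ℕ) (s ν : ℝ) :
    Set.EqOn (IopW n s ν fun θ => u θ - v θ) (fun θ => IopW n s ν u θ - IopW n s ν v θ)
      (Set.Ioc 0 (Real.pi / 2)) := fun θ hθ => by
  simp only [IopW, dW_congr (hu.dW_sub hv) hθ, hu.dW.dW_sub hv.dW hθ, hu.dW_sub hv hθ]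
  ring

lemma ladder_sub (hu : IsLogSmooth p j u) (hv : IsLogSmooth p' j' v) (a : ℝ) :
    Set.EqOn (ladder a fun θ => u θ - v θ) (fun θ => ladder a u θ - ladder a v θ)
      (Set.Ioc 0 (Real.pi / 2)) := fun θ hθ => by
  simp only [_root_.ladder, hu.dW_sub hv hθ]
  ring

lemma ladder_const_mul (hu : IsLogSmooth p j u) (a c : ℝ) :
    Set.EqOn (ladder a fun θ => c * u θ) (fun θ => c * ladder a u θ)
      (Set.Ioc 0 (Real.pi / 2)) := fun θ hθ => by
  simp only [_root_.ladder, hu.dW_const_mul c hθ]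
  ring

lemma ladder (hu : IsLogSmooth p j u) (a : ℝ) : IsLogSmooth p j (ladder a u) := by
  have h := hu.dW.sin_mul
  rw [sub_add_cancel] at h
  exact h.add (hu.smooth_mul (contDiff_const.mul Real.contDiff_cos))

/-- At the indicial exponent of the logarithmic term the ladder operator gains one order there. -/
lemma ladder_of_indicial (hu : IsLogSmooth p j u) {a : ℝ} (ha : a = -(p + j)) :
    IsLogSmooth p (j + 1) (_root_.ladder a u) := by
  obtain ⟨g₀, g₁, h₀, h₁, he⟩ := hu
  obtain ⟨σ, hσ, hσ0, hs⟩ := exists_smooth_sin_eq_mul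
  obtain ⟨τ, hτ, ht⟩ := exists_smooth_eq_add_mul (hσ.sub Real.contDiff_cos)
  have h₀' := contDiff_deriv_of_smooth h₀
  have h₁' := contDiff_deriv_of_smooth h₁
  have hcos := Real.contDiff_cos (n := ∞)
  refine ⟨fun θ => σ θ * (p * g₀ θ + θ * deriv g₀ θ + θ ^ j * g₁ θ) + a * Real.cos θ * g₀ θ,
    fun θ => (p + j) * τ θ * g₁ θ + σ θ * deriv g₁ θ, by fun_prop, by fun_prop, fun θ hθ => ?_⟩
  have hd := dW_eq_of_hasDerivWithinAt hθ
    ((hasDerivAt_rpow_mul_add_log h₀ h₁ p j hθ.1).hasDerivWithinAt.congr he (he θ hθ))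
  have hp : θ ^ p = θ ^ (p - 1) * θ := by
    rw [← Real.rpow_add_one hθ.1.ne', sub_add_cancel]
  have hc : Real.cos θ = σ θ - θ * τ θ := by
    have := ht θ
    simp only [hσ0, Real.cos_zero] at this
    linarith
  simp only [_root_.ladder, hd, he θ hθ, hs θ, hp, hc, ha]
  ring

/-- The product of two ladder operators. -/
lemma ladder_ladder (hu : IsLogSmooth p j u) (a b : ℝ) {θ : ℝ}
    (hθ : θ ∈ Set.Ioc 0 (Real.pi / 2)) :
    _root_.ladder a (_root_.ladder b u) θ =
      Real.sin θ ^ 2 * _root_.dW (_root_.dW u) θ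
        + (1 + a + b) * Real.sin θ * Real.cos θ * _root_.dW u θ
        + (a * b * Real.cos θ ^ 2 - b * Real.sin θ ^ 2) * u θ := by
  have hd : _root_.dW (_root_.ladder b u) θ = _ := dW_eq_of_hasDerivWithinAt hθ
    (((Real.hasDerivAt_sin θ).hasDerivWithinAt.mul (hu.dW.hasDerivWithinAt hθ)).add
      (((Real.hasDerivAt_cos θ).hasDerivWithinAt.const_mul b).mul (hu.hasDerivWithinAt hθ)))
  rw [_root_.ladder, hd, _root_.ladder]
  ring

lemma IopW_eq_ladder (hu : IsLogSmooth p j u) (n : ℕ) (s ν : ℝ) {θ : ℝ}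
    (hθ : θ ∈ Set.Ioc 0 (Real.pi / 2)) :
    IopW n s ν u θ = _root_.ladder (ν - n) (_root_.ladder (-ν) u) θ
      + (ν * (ν - n) + s * (n - s)) * u θ := by
  rw [hu.ladder_ladder _ _ hθ, IopW, Real.cos_sq']
  ring

lemma IopW_sub_one_eq_ladder (hu : IsLogSmooth p j u) (n : ℕ) (s ν : ℝ) {θ : ℝ}
    (hθ : θ ∈ Set.Ioc 0 (Real.pi / 2)) :
    IopW n s (ν - 1) u θ = _root_.ladder (-ν) (_root_.ladder (ν - n) u) θ
      + (ν * (ν - n) + s * (n - s)) * u θ := by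
  rw [hu.ladder_ladder _ _ hθ, IopW, Real.cos_sq']
  ring

end IsLogSmooth

/-- The resonant Euler equation `-j K + x K' + c xʲ = g` has a smooth solution for some `c`. -/
lemma exists_smooth_euler_resonant (j : ℕ) {g : ℝ → ℝ} (hg : ContDiff ℝ ∞ g) :
    ∃ (K : ℝ → ℝ) (c : ℝ), ContDiff ℝ ∞ K ∧
      ∀ x, -(j : ℝ) * K x + x * deriv K x + x ^ j * c = g x := by
  induction j generalizing g with
  | zero =>
    obtain ⟨k, hk, hgk⟩ := exists_smooth_eq_add_mul hg
    obtain ⟨h, hh, he⟩ := exists_smooth_euler 0 hk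
    refine ⟨fun x => x * h x, g 0, contDiff_id.mul hh, fun x => ?_⟩
    have hd := ((hasDerivAt_id x).mul (hh.differentiable (by simp) x).hasDerivAt).deriv
    have h1 : deriv (fun x => x * h x) x = 1 * h x + x * deriv h x := hd
    have h2 := he x
    rw [Nat.cast_zero, zero_add] at h2
    rw [h1, hgk x, ← h2]
    simp
    ring
  | succ j ih =>
    obtain ⟨k, hk, hgk⟩ := exists_smooth_eq_add_mul hg
    obtain ⟨K, c, hK, he⟩ := ih hk
    have hj : (j : ℝ) + 1 ≠ 0 := by positivity
    refine ⟨fun x => -(g 0 / (j + 1)) + x * K x, c, contDiff_const.add (contDiff_id.mul hK),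
      fun x => ?_⟩
    have h1 : deriv (fun x => -(g 0 / (j + 1)) + x * K x) x = 1 * K x + x * deriv K x :=
      (((hasDerivAt_id x).mul (hK.differentiable (by simp) x).hasDerivAt).const_add _).deriv
    rw [h1, hgk x, ← he x]
    push_cast
    field_simp
    ring

namespace IsLogSmooth

variable {p : ℝ} {j : ℕ} {f : ℝ → ℝ}

lemma exists_antideriv (hf : IsLogSmooth 0 j f) :
    ∃ V, IsLogSmooth 1 j V ∧ ∀ θ ∈ Set.Ioc 0 (Real.pi / 2),
      HasDerivWithinAt V (f θ) (Set.Ioc 0 (Real.pi / 2)) θ := by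
  obtain ⟨g₀, g₁, h₀, h₁, he⟩ := hf
  obtain ⟨H₁, hH₁, e₁⟩ := exists_smooth_euler j h₁
  obtain ⟨H₀, hH₀, e₀⟩ := exists_smooth_euler 0 (h₀.sub ((contDiff_id.pow j).mul hH₁))
  refine ⟨_, ⟨H₀, H₁, hH₀, hH₁, fun _ _ => rfl⟩, fun θ hθ => ?_⟩
  refine ((hasDerivAt_rpow_mul_add_log hH₀ hH₁ 1 j hθ.1).congr_deriv ?_).hasDerivWithinAt
  have h1 := e₁ θ
  have h0 := e₀ θ
  rw [Nat.cast_zero, zero_add] at h0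
  rw [he θ hθ, sub_self, Real.rpow_zero, ← h1]
  simp only [id] at h0
  linear_combination h0

lemma exists_antideriv_resonant (hf : IsLogSmooth (-(j + 1)) (j + 1) f) :
    ∃ U, IsLogSmooth (-j) j U ∧ ∀ θ ∈ Set.Ioc 0 (Real.pi / 2),
      HasDerivWithinAt U (f θ) (Set.Ioc 0 (Real.pi / 2)) θ := by
  obtain ⟨g₀, g₁, h₀, h₁, he⟩ := hf
  obtain ⟨h, hh, e₁⟩ := exists_smooth_euler 0 h₁
  obtain ⟨K, c, hK, e₀⟩ := exists_smooth_euler_resonant j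
    (g := fun x => g₀ x - x ^ (j + 1) * h x) (by fun_prop)
  have hL : ContDiff ℝ ∞ fun x => c + x * h x := by fun_prop
  refine ⟨_, ⟨K, fun x => c + x * h x, hK, hL, fun _ _ => rfl⟩, fun θ hθ => ?_⟩
  refine ((hasDerivAt_rpow_mul_add_log hK hL (-j) j hθ.1).congr_deriv ?_).hasDerivWithinAt
  have hd : deriv (fun x => c + x * h x) θ = 1 * h θ + θ * deriv h θ :=
    (((hasDerivAt_id θ).mul (hh.differentiable (by simp) θ).hasDerivAt).const_add _).deriv
  have h1 := e₁ θ
  have h0 := e₀ θ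
  simp only [Nat.cast_zero, zero_add] at h1
  rw [he θ hθ, hd, ← h1, neg_add']
  linear_combination θ ^ (-(j : ℝ) - 1) * h0

lemma const (j : ℕ) (c : ℝ) : IsLogSmooth (-j) j fun _ => c := by
  refine ⟨fun θ => c * θ ^ j, fun _ => 0, by fun_prop, contDiff_const, fun θ hθ => ?_⟩
  rw [Real.rpow_neg hθ.1.le, Real.rpow_natCast]
  have := pow_pos hθ.1 j
  field_simp
  ring

end IsLogSmooth

lemma sin_pos_of_mem_Ioc {θ : ℝ} (hθ : θ ∈ Set.Ioc 0 (Real.pi / 2)) : 0 < Real.sin θ :=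
  Real.sin_pos_of_pos_of_lt_pi hθ.1 (by linarith [hθ.2, Real.pi_pos])

lemma pi_div_two_mem_Ioc : Real.pi / 2 ∈ Set.Ioc 0 (Real.pi / 2) :=
  ⟨by positivity, le_rfl⟩

lemma hasDerivWithinAt_sin_rpow_mul {V : ℝ → ℝ} {a d θ : ℝ} (hθ : θ ∈ Set.Ioc 0 (Real.pi / 2))
    (h : HasDerivWithinAt V d (Set.Ioc 0 (Real.pi / 2)) θ) :
    HasDerivWithinAt (fun θ => Real.sin θ ^ a * V θ)
      (Real.sin θ ^ (a - 1) * (Real.sin θ * d + a * Real.cos θ * V θ))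
      (Set.Ioc 0 (Real.pi / 2)) θ := by
  have hs := sin_pos_of_mem_Ioc hθ
  have h1 := ((Real.hasDerivAt_sin θ).rpow_const (p := a) (Or.inl hs.ne')).hasDerivWithinAt
    (s := Set.Ioc 0 (Real.pi / 2))
  refine (h1.mul h).congr_deriv ?_
  have : Real.sin θ ^ a = Real.sin θ ^ (a - 1) * Real.sin θ := by
    rw [← Real.rpow_add_one hs.ne', sub_add_cancel]
  rw [this]
  ring

lemma ladder_sin_rpow_mul {V : ℝ → ℝ} {a b d θ : ℝ} (hθ : θ ∈ Set.Ioc 0 (Real.pi / 2))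
    (h : HasDerivWithinAt V d (Set.Ioc 0 (Real.pi / 2)) θ) (hb : b = -a) :
    ladder b (fun θ => Real.sin θ ^ a * V θ) θ = Real.sin θ ^ (a + 1) * d := by
  have hs := sin_pos_of_mem_Ioc hθ
  rw [ladder, dW_eq_of_hasDerivWithinAt hθ (hasDerivWithinAt_sin_rpow_mul hθ h), hb,
    Real.rpow_sub_one hs.ne', Real.rpow_add_one hs.ne']
  field_simp
  ring

/-- The kernel of a ladder operator is spanned by a power of the sine. -/
lemma sin_rpow_mul_eq_of_ladder_eq_zero {p a : ℝ} {j : ℕ} {v : ℝ → ℝ} (hv : IsLogSmooth p j v)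
    (h : ∀ θ ∈ Set.Ioc 0 (Real.pi / 2), ladder a v θ = 0) {θ : ℝ}
    (hθ : θ ∈ Set.Ioc 0 (Real.pi / 2)) :
    Real.sin θ ^ a * v θ = v (Real.pi / 2) := by
  have := (convex_Ioc (0 : ℝ) (Real.pi / 2)).norm_image_sub_le_of_norm_hasDerivWithin_le
    (f := fun θ => Real.sin θ ^ a * v θ) (C := 0)
    (fun x hx => hasDerivWithinAt_sin_rpow_mul hx (hv.hasDerivWithinAt hx))
    (fun x hx => by
      have := h x hx
      rw [ladder] at this
      rw [this]
      simp) hθ pi_div_two_mem_Ioc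
  simp only [zero_mul, norm_le_zero_iff, sub_eq_zero, Real.sin_pi_div_two, Real.one_rpow,
    one_mul] at this
  exact this.symm

lemma tendsto_pow_mul_log (j : ℕ) :
    Tendsto (fun θ : ℝ => θ ^ (j + 1) * Real.log θ) (𝓝[>] 0) (𝓝 0) := by
  have h := tendsto_log_mul_rpow_nhdsGT_zero (r := (j : ℝ) + 1) (by positivity)
  refine h.congr fun θ => ?_
  rw [mul_comm, ← Real.rpow_natCast]
  push_cast
  rfl

lemma eventually_mem_Ioc : ∀ᶠ θ in 𝓝[>] (0 : ℝ), θ ∈ Set.Ioc 0 (Real.pi / 2) :=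
  Ioc_mem_nhdsGT (by positivity)

namespace IsLogSmooth

variable {p : ℝ} {j : ℕ} {u : ℝ → ℝ}

lemma tendsto_rpow_mul (hu : IsLogSmooth p j u) {a : ℝ} (ha : a = 1 - p) :
    Tendsto (fun θ => θ ^ a * u θ) (𝓝[>] 0) (𝓝 0) := by
  obtain ⟨g₀, g₁, h₀, h₁, he⟩ := hu
  have t₀ : Tendsto g₀ (𝓝[>] 0) (𝓝 (g₀ 0)) := h₀.continuous.continuousAt.mono_left inf_le_left
  have t₁ : Tendsto g₁ (𝓝[>] 0) (𝓝 (g₁ 0)) := h₁.continuous.continuousAt.mono_left inf_le_left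
  have ti : Tendsto (fun θ : ℝ => θ) (𝓝[>] 0) (𝓝 0) := tendsto_id.mono_left inf_le_left
  have := (ti.mul t₀).add ((tendsto_pow_mul_log j).mul t₁)
  rw [zero_mul, zero_mul, add_zero] at this
  refine this.congr' ?_
  filter_upwards [eventually_mem_Ioc] with θ hθ
  rw [he θ hθ, ← mul_assoc, ← Real.rpow_add hθ.1, ha, sub_add_cancel, Real.rpow_one]
  ring

lemma eq_zero_of_ladder (hu : IsLogSmooth p j u) {a : ℝ} (ha : a = 1 - p)
    (h : ∀ θ ∈ Set.Ioc 0 (Real.pi / 2), _root_.ladder a u θ = 0) :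
    ∀ θ ∈ Set.Ioc 0 (Real.pi / 2), u θ = 0 := by
  obtain ⟨τ, hτ, ht⟩ := exists_smooth_sin_rpow a
  have tt : Tendsto τ (𝓝[>] 0) (𝓝 (τ 0)) := hτ.continuous.continuousAt.mono_left inf_le_left
  have h1 := tt.mul (hu.tendsto_rpow_mul ha)
  rw [mul_zero] at h1
  have h2 : Tendsto (fun _ : ℝ => u (Real.pi / 2)) (𝓝[>] 0) (𝓝 0) := by
    refine h1.congr' ?_
    filter_upwards [eventually_mem_Ioc] with θ hθ
    rw [← sin_rpow_mul_eq_of_ladder_eq_zero hu h hθ, ht θ hθ]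
    ring
  have h3 : u (Real.pi / 2) = 0 := tendsto_nhds_unique tendsto_const_nhds h2
  intro θ hθ
  have h4 := sin_rpow_mul_eq_of_ladder_eq_zero hu h hθ
  rw [h3] at h4
  exact (mul_eq_zero.1 h4).resolve_left (Real.rpow_pos_of_pos (sin_pos_of_mem_Ioc hθ) a).ne'

end IsLogSmooth

section Indicial

variable {n : ℕ} {s : ℝ} {j : ℕ}

lemma exists_indicial_solution_zero (hj : 2 * s = n + j + 1) {f : ℝ → ℝ}
    (hf : IsLogSmooth (n - s + 1) (j + 1) f) (c : ℝ) :
    ∃ u, IsLogSmooth (n - s + 1) j u ∧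
      (∀ θ ∈ Set.Ioc 0 (Real.pi / 2), IopW n s s u θ = f θ) ∧ u (Real.pi / 2) = c := by
  have hf' := hf.sin_rpow_mul (s - n - 1)
  rw [show (n : ℝ) - s + 1 + (s - n - 1) = 0 by ring] at hf'
  obtain ⟨V, hV, dV⟩ := hf'.exists_antideriv
  have hv := hV.sin_rpow_mul (n - s)
  have hw := hv.sin_rpow_mul (-s - 1)
  rw [show 1 + ((n : ℝ) - s) + (-s - 1) = -(j + 1) by linarith] at hw
  obtain ⟨U, hU, dU⟩ := hw.exists_antideriv_resonant
  have hu := (hU.add (IsLogSmooth.const j (c - U (Real.pi / 2)))).sin_rpow_mul s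
  rw [show -(j : ℝ) + s = n - s + 1 by linarith] at hu
  refine ⟨_, hu, fun θ hθ => ?_, by simp⟩
  have h1 : Set.EqOn (ladder (-s) fun θ => Real.sin θ ^ s * (U θ + (c - U (Real.pi / 2))))
      (fun θ => Real.sin θ ^ ((n : ℝ) - s) * V θ) (Set.Ioc 0 (Real.pi / 2)) := fun θ hθ => by
    rw [ladder_sin_rpow_mul hθ ((dU θ hθ).add_const _) rfl, ← mul_assoc,
      ← Real.rpow_add (sin_pos_of_mem_Ioc hθ), show s + 1 + (-s - 1) = 0 by ring,
      Real.rpow_zero, one_mul]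
  rw [hu.IopW_eq_ladder _ _ _ hθ, ladder_congr _ h1 hθ, ladder_sin_rpow_mul hθ (dV θ hθ) (by ring),
    ← mul_assoc, ← Real.rpow_add (sin_pos_of_mem_Ioc hθ),
    show (n : ℝ) - s + 1 + (s - n - 1) = 0 by ring, Real.rpow_zero]
  ring

lemma indicial_const_pos (hj : 2 * s = n + j + 1) (q : ℕ) :
    0 < (s + (q + 1 : ℕ)) * (s + (q + 1 : ℕ) - n) + s * (n - s) := by
  have : (s + (q + 1 : ℕ)) * (s + (q + 1 : ℕ) - n) + s * (n - s)
      = ((q : ℝ) + 1) * (q + 1 + (j + 1)) := by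
    have : (n : ℝ) = 2 * s - j - 1 := by linarith
    push_cast
    rw [this]
    ring
  rw [this]
  positivity

lemma ladder_pi_div_two (a : ℝ) (u : ℝ → ℝ) : ladder a u (Real.pi / 2) = dW u (Real.pi / 2) := by
  simp [ladder]

/-- The indicial equation is solvable with a Neumann condition at `π/2` for odd `q` and with a
Dirichlet condition for even `q`. -/
lemma exists_indicial_solution (hj : 2 * s = n + j + 1) (q : ℕ) {f : ℝ → ℝ}
    (hf : IsLogSmooth (n - s + 1) (j + 1) f) (c : ℝ) :
    ∃ u, IsLogSmooth (n - s + 1) j u ∧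
      (∀ θ ∈ Set.Ioc 0 (Real.pi / 2), IopW n s (s + q) u θ = f θ) ∧
      (Odd q → dW u (Real.pi / 2) = c) ∧ (Even q → u (Real.pi / 2) = c) := by
  induction q generalizing f c with
  | zero =>
    obtain ⟨u, hu, he, hc⟩ := exists_indicial_solution_zero hj hf c
    exact ⟨u, hu, by simpa using he, by simp, fun _ => hc⟩
  | succ q ih =>
    set ν : ℝ := s + (q + 1 : ℕ) with hν
    set κ : ℝ := ν * (ν - n) + s * (n - s) with hκ
    have hκ0 : κ ≠ 0 := (indicial_const_pos hj q).ne'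
    have hν1 : s + q = ν - 1 := by rw [hν]; push_cast; ring
    obtain ⟨y, hy, ey, yo, ye⟩ := ih (hf.ladder (-ν))
      (if Even q then c else f (Real.pi / 2) - κ * c)
    rw [hν1] at ey
    have hd := hf.of_succ.sub (hy.ladder (ν - n))
    have hu := hd.const_mul κ⁻¹
    have h1 : Set.EqOn (ladder (-ν) fun θ => κ⁻¹ * (f θ - ladder (ν - n) y θ)) y
        (Set.Ioc 0 (Real.pi / 2)) := fun θ hθ => by
      rw [hd.ladder_const_mul _ _ hθ]
      beta_reduce
      rw [hf.ladder_sub (hy.ladder _) _ hθ]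
      have h2 := hy.IopW_sub_one_eq_ladder n s ν hθ
      rw [ey θ hθ, ← hκ] at h2
      beta_reduce
      rw [h2]
      field_simp
      ring
    refine ⟨_, hu, fun θ hθ => ?_, fun ho => ?_, fun he => ?_⟩
    · rw [hu.IopW_eq_ladder _ _ _ hθ, ladder_congr _ h1 hθ, ← hκ]
      field_simp
      ring
    · have hq : Even q := by
        rw [Nat.odd_add_one, Nat.not_odd_iff_even] at ho
        exact ho
      rw [← ladder_pi_div_two (-ν), h1 pi_div_two_mem_Ioc, ye hq, if_pos hq]
    · have hq : ¬ Even q := by rwa [Nat.even_add_one] at he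
      rw [ladder_pi_div_two, yo (Nat.not_even_iff_odd.1 hq), if_neg hq]
      field_simp
      ring

lemma eq_zero_of_indicial (hj : 2 * s = n + j + 1) (q : ℕ) {u : ℝ → ℝ}
    (hu : IsLogSmooth (n - s + 1) j u)
    (h : ∀ θ ∈ Set.Ioc 0 (Real.pi / 2), IopW n s (s + q) u θ = 0)
    (ho : Odd q → dW u (Real.pi / 2) = 0) (he : Even q → u (Real.pi / 2) = 0) :
    ∀ θ ∈ Set.Ioc 0 (Real.pi / 2), u θ = 0 := by
  induction q generalizing u with
  | zero =>
    have h1 : ∀ θ ∈ Set.Ioc 0 (Real.pi / 2), ladder (-s) u θ = 0 := by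
      refine (hu.ladder (-s)).eq_zero_of_ladder (a := s - n) (by ring) fun θ hθ => ?_
      have := h θ hθ
      rw [Nat.cast_zero, add_zero, hu.IopW_eq_ladder _ _ _ hθ] at this
      linear_combination this
    intro θ hθ
    have h2 := sin_rpow_mul_eq_of_ladder_eq_zero hu h1 hθ
    rw [he Even.zero] at h2
    exact (mul_eq_zero.1 h2).resolve_left (Real.rpow_pos_of_pos (sin_pos_of_mem_Ioc hθ) _).ne'
  | succ q ih =>
    set ν : ℝ := s + (q + 1 : ℕ) with hν
    set κ : ℝ := ν * (ν - n) + s * (n - s) with hκ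
    have hκ0 : κ ≠ 0 := (indicial_const_pos hj q).ne'
    have hν1 : s + q = ν - 1 := by rw [hν]; push_cast; ring
    have h1 : Set.EqOn (ladder (ν - n) (ladder (-ν) u)) (fun θ => -κ * u θ)
        (Set.Ioc 0 (Real.pi / 2)) := fun θ hθ => by
      have := h θ hθ
      rw [hu.IopW_eq_ladder _ _ _ hθ, ← hκ] at this
      linear_combination this
    have h2 : ∀ θ ∈ Set.Ioc 0 (Real.pi / 2), ladder (-ν) u θ = 0 := by
      refine ih (hu.ladder _) (fun θ hθ => ?_) (fun hq => ?_) (fun hq => ?_)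
      · rw [hν1, (hu.ladder _).IopW_sub_one_eq_ladder _ _ _ hθ, ladder_congr _ h1 hθ,
          hu.ladder_const_mul _ _ hθ, ← hκ]
        ring
      · rw [← ladder_pi_div_two (ν - n), h1 pi_div_two_mem_Ioc]
        beta_reduce
        rw [he (Odd.add_one hq), mul_zero]
      · rw [ladder_pi_div_two, ho (Even.add_one hq)]
    intro θ hθ
    have h3 : ladder (ν - n) (ladder (-ν) u) θ = 0 := by
      rw [ladder_congr _ (v := fun _ => 0) h2 hθ, ladder]
      simp [dW]
    rw [h1 hθ] at h3
    exact (mul_eq_zero.1 h3).resolve_left (neg_ne_zero.2 hκ0)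

lemma IsLogSmooth.IopW (hj : 2 * s = n + j + 1) (ν : ℝ) {u : ℝ → ℝ}
    (hu : IsLogSmooth (n - s + 1) j u) : IsLogSmooth (n - s + 1) (j + 1) (IopW n s ν u) := by
  have h1 := (hu.ladder_of_indicial (a := -s) (by linarith)).ladder (s - n)
  have h2 := ((hu.sin_mul.smooth_mul Real.contDiff_sin).of_add_one).const_mul
    (ν * (ν + 1 - n) - s * (s + 1 - n))
  refine (h1.add h2).congr fun θ hθ => ?_
  have h3 := hu.IopW_eq_ladder n s s hθ
  simp only [_root_.IopW] at h3 ⊢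
  linear_combination h3

lemma memB_iff (hj : 2 * s = n + j + 1) {f : ℝ → ℝ} :
    memB n s f ↔ IsLogSmooth (n - s + 1) (j + 1) f := by
  have key : ∀ θ ∈ Set.Ioc 0 (Real.pi / 2),
      θ ^ (s + 1) = θ ^ ((n : ℝ) - s + 1) * θ ^ (j + 1) := fun θ hθ => by
    rw [← Real.rpow_add_natCast hθ.1.ne']
    congr 1
    push_cast
    linarith
  constructor
  · rintro ⟨g₀, g₁, h₀, h₁, h⟩
    refine ⟨g₀, g₁, h₀, h₁, fun θ hθ => ?_⟩
    rw [h θ hθ, key θ hθ]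
    ring
  · rintro ⟨g₀, g₁, h₀, h₁, h⟩
    refine ⟨g₀, g₁, h₀, h₁, fun θ hθ => ?_⟩
    rw [h θ hθ, key θ hθ]
    ring

lemma memA0_iff (hj : 2 * s = n + j + 1) {u : ℝ → ℝ} :
    memA0 n s u ↔ IsLogSmooth (n - s + 1) j u ∧ dW u (Real.pi / 2) = 0 := by
  have key : ∀ θ ∈ Set.Ioc 0 (Real.pi / 2),
      θ ^ s = θ ^ ((n : ℝ) - s) * (θ * θ ^ j) := fun θ hθ => by
    rw [← pow_succ', ← Real.rpow_add_natCast hθ.1.ne']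
    congr 1
    push_cast
    linarith
  constructor
  · rintro ⟨⟨g₀, g₁, h₀, h₁, h⟩, ht, hd⟩
    refine ⟨?_, hd⟩
    have t₀ : Tendsto g₀ (𝓝[>] 0) (𝓝 (g₀ 0)) := h₀.continuous.continuousAt.mono_left inf_le_left
    have t₁ : Tendsto g₁ (𝓝[>] 0) (𝓝 (g₁ 0)) := h₁.continuous.continuousAt.mono_left inf_le_left
    have h2 := t₀.add ((tendsto_pow_mul_log j).mul t₁)
    rw [zero_mul, add_zero] at h2
    have h3 : g₀ 0 = 0 := by
      refine tendsto_nhds_unique (h2.congr' ?_) ht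
      filter_upwards [eventually_mem_Ioc] with θ hθ
      have h4 : θ ^ (s - (n : ℝ)) * θ ^ ((n : ℝ) - s) = 1 := by
        rw [← Real.rpow_add hθ.1, sub_add_sub_cancel, sub_self, Real.rpow_zero]
      rw [h θ hθ, key θ hθ]
      linear_combination -(g₀ θ + θ ^ (j + 1) * Real.log θ * g₁ θ) * h4
    obtain ⟨k, hk, hgk⟩ := exists_smooth_eq_add_mul h₀
    refine ⟨k, g₁, hk, h₁, fun θ hθ => ?_⟩
    rw [h θ hθ, key θ hθ, hgk θ, h3, Real.rpow_add_one hθ.1.ne']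
    ring
  · rintro ⟨hu, hd⟩
    refine ⟨?_, hu.tendsto_rpow_mul (by ring), hd⟩
    obtain ⟨g₀, g₁, h₀, h₁, h⟩ := hu
    refine ⟨fun θ => θ * g₀ θ, g₁, contDiff_id.mul h₀, h₁, fun θ hθ => ?_⟩
    rw [h θ hθ, key θ hθ, Real.rpow_add_one hθ.1.ne']
    ring

end Indicial

lemma memA0_zero {n : ℕ} {s : ℝ} : memA0 n s fun _ => 0 :=
  ⟨⟨fun _ => 0, fun _ => 0, contDiff_const, contDiff_const, by simp⟩, by simp, by simp [dW]⟩

lemma exists_two_mul_eq {n : ℕ} {s : ℝ} (hs : (n : ℝ) / 2 < s) (h2s : ∃ z : ℤ, 2 * s = (z : ℝ)) :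
    ∃ j : ℕ, 2 * s = n + j + 1 := by
  obtain ⟨z, hz⟩ := h2s
  have h1 : (n : ℤ) < z := by
    have : (n : ℝ) < z := by linarith
    exact_mod_cast this
  refine ⟨(z - n - 1).toNat, ?_⟩
  have h2 : (((z - n - 1).toNat : ℤ) : ℝ) = ((z - n - 1 : ℤ) : ℝ) := by
    rw [Int.toNat_of_nonneg (by linarith)]
  push_cast at h2
  rw [hz, h2]
  ring

section Tuples

variable {n : ℕ} {s : ℝ} {j m : ℕ}

lemma memB_Jmap (hj : 2 * s = n + j + 1) (ν : ℝ) {b : ℕ → ℝ → ℝ}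
    (hb : ∀ i, memA0 n s (b i)) (i : ℕ) : memB n s (Jmap n s ν b i) := by
  have hsin : ∀ i, IsLogSmooth (n - s + 1) (j + 1) fun θ => Real.sin θ * (Real.sin θ * b i θ) :=
    fun i => (((memA0_iff hj).1 (hb i)).1.sin_mul.smooth_mul Real.contDiff_sin).of_add_one
  refine (memB_iff hj).2 ((((((memA0_iff hj).1 (hb i)).1.IopW hj ν).add
    ((hsin (i + 1)).const_mul (((i : ℝ) + 1) * (ν - i)))).add
    ((hsin (i + 2)).const_mul (((i : ℝ) + 2) * (i + 1)))).congr fun θ _ => ?_)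
  rw [Jmap]
  ring

lemma exists_Jmap_eq (hj : 2 * s = n + j + 1) {q : ℕ} (hq : Odd q) {f : ℕ → ℝ → ℝ}
    (hf : ∀ i ≤ m, memB n s (f i)) (t : ℕ) (ht : t ≤ m + 1) :
    ∃ b : ℕ → ℝ → ℝ, (∀ i, memA0 n s (b i)) ∧ (∀ i, m < i → b i = fun _ => 0) ∧
      ∀ i ≤ m, m + 1 ≤ i + t → ∀ θ ∈ Set.Ioc 0 (Real.pi / 2),
        Jmap n s (s + (q : ℝ)) b i θ = f i θ := by
  induction t with
  | zero => exact ⟨fun _ _ => 0, fun _ => memA0_zero, fun _ _ => rfl, fun i _ _ => by omega⟩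
  | succ t ih =>
    obtain ⟨b, hb, hb0, he⟩ := ih (by omega)
    obtain ⟨i₀, hi₀⟩ : ∃ i₀, i₀ + t = m := ⟨m - t, by omega⟩
    have hsin : ∀ i, IsLogSmooth (n - s + 1) (j + 1)
        fun θ => Real.sin θ * (Real.sin θ * b i θ) := fun i =>
      (((memA0_iff hj).1 (hb i)).1.sin_mul.smooth_mul Real.contDiff_sin).of_add_one
    obtain ⟨u, hu, eu, hu0, -⟩ := exists_indicial_solution hj q
      ((((memB_iff hj).1 (hf i₀ (by omega))).sub
        ((hsin (i₀ + 1)).const_mul (((i₀ : ℝ) + 1) * (s + (q : ℝ) - i₀)))).sub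
        ((hsin (i₀ + 2)).const_mul (((i₀ : ℝ) + 2) * (i₀ + 1)))) 0
    refine ⟨Function.update b i₀ u, fun i => ?_, fun i hi => ?_, fun i him hit θ hθ => ?_⟩
    · rcases eq_or_ne i i₀ with rfl | hne
      · rw [Function.update_self]
        exact (memA0_iff hj).2 ⟨hu, hu0 hq⟩
      · rw [Function.update_of_ne hne]
        exact hb i
    · rw [Function.update_of_ne (by omega)]
      exact hb0 i hi
    · have h1 : Function.update b i₀ u (i + 1) = b (i + 1) :=
        Function.update_of_ne (by omega) _ _
      have h2 : Function.update b i₀ u (i + 2) = b (i + 2) :=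
        Function.update_of_ne (by omega) _ _
      rw [Jmap, h1, h2]
      rcases eq_or_ne i i₀ with rfl | hne
      · rw [Function.update_self, eu θ hθ]
        ring
      · rw [Function.update_of_ne hne, ← he i him (by omega) θ hθ, Jmap]

lemma eqOn_of_Jmap_eq (hj : 2 * s = n + j + 1) {q : ℕ} (hq : Odd q) {b b' : ℕ → ℝ → ℝ}
    (hb : ∀ i ≤ m, memA0 n s (b i)) (hb' : ∀ i ≤ m, memA0 n s (b' i))
    (h0 : ∀ i, m < i → b i = b' i)
    (h : ∀ i ≤ m, ∀ θ ∈ Set.Ioc 0 (Real.pi / 2),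
      Jmap n s (s + (q : ℝ)) b i θ = Jmap n s (s + (q : ℝ)) b' i θ)
    (t : ℕ) : ∀ i, m < i + t → Set.EqOn (b i) (b' i) (Set.Ioc 0 (Real.pi / 2)) := by
  induction t with
  | zero => exact fun i hi θ _ => congrFun (h0 i hi) θ
  | succ t ih =>
    intro i hi
    by_cases him : m < i
    · exact fun θ _ => congrFun (h0 i him) θ
    have hi' : i ≤ m := not_lt.1 him
    obtain ⟨hu, du⟩ := (memA0_iff hj).1 (hb i hi')
    obtain ⟨hu', du'⟩ := (memA0_iff hj).1 (hb' i hi')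
    have := eq_zero_of_indicial hj q (hu.sub hu') (fun θ hθ => ?_) (fun _ => ?_)
      (fun he => absurd he (Nat.not_even_iff_odd.2 hq))
    · exact fun θ hθ => sub_eq_zero.1 (this θ hθ)
    · rw [hu.IopW_sub hu' _ _ _ hθ]
      have h1 := h i hi' θ hθ
      rw [Jmap, Jmap, ih (i + 1) (by omega) hθ, ih (i + 2) (by omega) hθ] at h1
      linear_combination h1
    · rw [hu.dW_sub hu' pi_div_two_mem_Ioc]
      beta_reduce
      rw [du, du', sub_zero]

end Tuples

/-- for `2s ∈ ℤ`, odd `q ≥ 1`, `ν = s + q`, `m = (q+1)/2`, the map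
`J : (A⁰)^{m+1} → B^{m+1}` is well defined and bijective (as maps of functions
on `(0, π/2]`). -/
theorem stmt_16 (n : ℕ) (hn : 2 ≤ n) (s : ℝ) (hs : (n : ℝ) / 2 < s)
    (h2s : ∃ z : ℤ, 2 * s = (z : ℝ))
    (q : ℕ) (hq1 : 1 ≤ q) (hqodd : Odd q)
    (m : ℕ) (hm : 2 * m = q + 1) :
    (∀ b : ℕ → ℝ → ℝ, (∀ i ≤ m, memA0 n s (b i)) →
      (∀ j, m < j → b j = fun _ => 0) →
      ∀ i ≤ m, memB n s (Jmap n s (s + (q : ℝ)) b i)) ∧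
    (∀ f : ℕ → ℝ → ℝ, (∀ i ≤ m, memB n s (f i)) →
      ∃ b : ℕ → ℝ → ℝ, (∀ i ≤ m, memA0 n s (b i)) ∧
        (∀ j, m < j → b j = fun _ => 0) ∧
        ∀ i ≤ m, ∀ θ ∈ Set.Ioc 0 (Real.pi / 2),
          Jmap n s (s + (q : ℝ)) b i θ = f i θ) ∧
    (∀ b b' : ℕ → ℝ → ℝ,
      (∀ i ≤ m, memA0 n s (b i)) → (∀ j, m < j → b j = fun _ => 0) →
      (∀ i ≤ m, memA0 n s (b' i)) → (∀ j, m < j → b' j = fun _ => 0) →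
      (∀ i ≤ m, ∀ θ ∈ Set.Ioc 0 (Real.pi / 2),
        Jmap n s (s + (q : ℝ)) b i θ = Jmap n s (s + (q : ℝ)) b' i θ) →
      ∀ i ≤ m, ∀ θ ∈ Set.Ioc 0 (Real.pi / 2), b i θ = b' i θ) := by
  obtain ⟨j, hj⟩ := exists_two_mul_eq hs h2s
  refine ⟨fun b hb hb0 i _ => memB_Jmap hj _ (fun i => ?_) i, fun f hf => ?_,
    fun b b' hb hb0 hb' hb0' h i _ θ hθ => ?_⟩
  · rcases le_or_gt i m with hi | hi
    · exact hb i hi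
    · rw [hb0 i hi]
      exact memA0_zero
  · obtain ⟨b, hb, hb0, he⟩ := exists_Jmap_eq hj hqodd hf (m + 1) le_rfl
    exact ⟨b, fun i _ => hb i, hb0, fun i hi => he i hi (by omega)⟩
  · exact eqOn_of_Jmap_eq hj hqodd hb hb' (fun i hi => (hb0 i hi).trans (hb0' i hi).symm) h
      (m + 1) i (by omega) hθ
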